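/- For every natural number n there exists a finite solvable group G such that every maximal subgroup M of G with π(M) = π(G) is supersolvable, and the nilpotency (Fitting) length of G is at least n, i.e., G admits no chain of normal subgroups 1 = G₀ ≤ G₁ ≤ ... ≤ G_m = G with m < n, each G_i normal in G, and every quotient G_{i+1}/G_i nilpotent. -/

import Mathlib

/-- A group is supersolvable if it has a chain of subgroups, each normal in the
whole group, starting at the trivial subgroup and ending at the whole group,
with all successive quotients cyclic. -/
def IsSupersolvable (M : Type*) [Group M] : Prop :=
  ∃ (k : ℕ) (c : ℕ → Subgroup M),
    c 0 = ⊥ ∧ c k = ⊤ ∧ (∀ i, c i ≤ c (i + 1)) ∧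
    ∃ hn : ∀ i, (c i).Normal,
      ∀ i < k, letI := hn i;
        IsCyclic ((c (i + 1)).map (QuotientGroup.mk' (c i)))

/-- `c` is a normal chain of length `m` for `G` from `⊥` to `⊤` with all
successive quotients nilpotent. -/
def IsNilpotentNormalChain (G : Type*) [Group G] (m : ℕ) (c : ℕ → Subgroup G) : Prop :=
  c 0 = ⊥ ∧ c m = ⊤ ∧ (∀ i, c i ≤ c (i + 1)) ∧
  ∃ hn : ∀ i, (c i).Normal,
    ∀ i < m, letI := hn i;
      Group.IsNilpotent ((c (i + 1)).map (QuotientGroup.mk' (c i)))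

namespace FittingTower

open Subgroup

/-- The homomorphic image of a nilpotent subgroup is nilpotent. -/
theorem isNilpotent_map {G H : Type*} [Group G] [Group H] (f : G →* H) (K : Subgroup G)
    [Group.IsNilpotent K] : Group.IsNilpotent (K.map f) :=
  Group.nilpotent_of_surjective (f.subgroupMap K) (f.subgroupMap_surjective K)

/-- A nontrivial normal subgroup which is minimal among nontrivial normal subgroups and equal
to its own centralizer. -/
structure IsSelfCentralizingMinimal {E : Type*} [Group E] (V : Subgroup E) : Prop where
  normal : V.Normal
  ne_bot : V ≠ ⊥
  minimal : ∀ N : Subgroup E, N.Normal → N ≤ V → N = ⊥ ∨ N = V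
  centralizer_eq : centralizer (V : Set E) = V

namespace IsSelfCentralizingMinimal

variable {E : Type*} [Group E] {V : Subgroup E}

theorem le_or_commutator_eq (hV : IsSelfCentralizingMinimal V) (N : Subgroup E) [N.Normal] :
    N ≤ V ∨ ⁅V, N⁆ = V := by
  have := hV.normal
  refine (hV.minimal ⁅V, N⁆ inferInstance (commutator_le_left V N)).imp_left fun h => ?_
  rw [commutator_comm, commutator_eq_bot_iff_le_centralizer] at h
  exact h.trans hV.centralizer_eq.le

/-- Every nontrivial normal subgroup contains `V`. -/
theorem eq_bot_or_le (hV : IsSelfCentralizingMinimal V) (N : Subgroup E) [hN : N.Normal] :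
    N = ⊥ ∨ V ≤ N := by
  rcases hV.le_or_commutator_eq N with h | h
  · exact (hV.minimal N hN h).imp_right fun h => h.ge
  · exact .inr (h.symm.le.trans (commutator_le_right V N))

/-- Every nilpotent normal subgroup is contained in `V`. -/
theorem le_of_isNilpotent (hV : IsSelfCentralizingMinimal V) (N : Subgroup E) [N.Normal]
    [hnil : Group.IsNilpotent N] : N ≤ V := by
  refine (hV.le_or_commutator_eq N).resolve_right fun h => ?_
  obtain ⟨n, hn⟩ := (isNilpotent_iff_lowerCentralSeries N).1 hnil
  have hle : ∀ i, V ≤ N.lowerCentralSeries i := by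
    intro i
    induction i with
    | zero => exact h.symm.le.trans (commutator_le_right V N)
    | succ i ih => exact h.symm.le.trans (commutator_mono ih le_rfl)
  exact hV.ne_bot (le_bot_iff.1 (hn ▸ hle n))

/-- A maximal subgroup which does not contain `V` meets it trivially. -/
theorem inf_eq_bot_of_isCoatom (hV : IsSelfCentralizingMinimal V) {M : Subgroup E}
    (hM : IsCoatom M) (hVM : ¬ V ≤ M) : M ⊓ V = ⊥ := by
  have := hV.normal
  have hsup : M ⊔ V = ⊤ := hM.2 _ (left_lt_sup.2 hVM)
  have hnormal : (M ⊓ V).Normal := by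
    rw [← normalizer_eq_top_iff, eq_top_iff, ← hsup, sup_le_iff]
    constructor
    · rw [le_normalizer_iff_commutator_le_right]
      exact le_inf ((commutator_mono le_rfl inf_le_left).trans (commutator_le_self M))
        ((commutator_mono le_rfl inf_le_right).trans (commutator_le_right M V))
    · have h : ⁅V, M ⊓ V⁆ = ⊥ := by
        rw [commutator_eq_bot_iff_le_centralizer]
        exact hV.centralizer_eq.ge.trans (centralizer_le inf_le_right)
      rw [le_normalizer_iff_commutator_le_right, h]
      exact bot_le
  exact (hV.minimal _ hnormal inf_le_right).resolve_right fun h => hVM (inf_eq_right.1 h)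

end IsSelfCentralizingMinimal

/-- A finite solvable group of Fitting length at least `k`, with a unique minimal normal subgroup,
each of whose maximal subgroups has order prime to some prime divisor of the group order. -/
structure IsTower (k : ℕ) (G : Type*) [Group G] : Prop where
  solvable : Group.IsSolvable G
  exists_prime_not_dvd : ∀ M : Subgroup G, IsCoatom M →
    ∃ q : ℕ, q.Prime ∧ q ∣ Nat.card G ∧ ¬ q ∣ Nat.card M
  exists_monolith : ∃ g : G, g ≠ 1 ∧ ∀ N : Subgroup G, N.Normal → N = ⊥ ∨ g ∈ N
  le_length : ∀ (m : ℕ) (c : ℕ → Subgroup G), IsNilpotentNormalChain G m c → k ≤ m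

section Extension

variable {E G : Type*} [Group E] [Group G]

/-- If the first term of a nilpotent normal chain lies in the kernel of a surjection `f`, then
its image under `f` is a chain which is shorter by one. -/
theorem isNilpotentNormalChain_map {f : E →* G} (hf : Function.Surjective f) {m : ℕ}
    {c : ℕ → Subgroup E} (hc : IsNilpotentNormalChain E (m + 1) c) (h1 : c 1 ≤ f.ker) :
    IsNilpotentNormalChain G m fun i => (c (i + 1)).map f := by
  obtain ⟨-, htop, hle, hn, hnil⟩ := hc
  refine ⟨(Subgroup.map_eq_bot_iff _).2 h1, ?_, fun i => map_mono (hle _), fun i => (hn _).map f hf, ?_⟩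
  · simp only [htop]
    exact map_top_of_surjective f hf
  · intro i hi
    have := hn (i + 1)
    have := (hn (i + 1)).map f hf
    have := hnil (i + 1) (by omega)
    have key := isNilpotent_map
      (QuotientGroup.map (c (i + 1)) ((c (i + 1)).map f) f (le_comap_map f _))
      ((c (i + 1 + 1)).map (QuotientGroup.mk' (c (i + 1))))
    rw [map_map] at key
    change Group.IsNilpotent
      (((c (i + 1 + 1)).map f).map (QuotientGroup.mk' ((c (i + 1)).map f)))
    rw [map_map]
    exact key

theorem isNilpotent_one_of_chain {m : ℕ} {c : ℕ → Subgroup E}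
    (hc : IsNilpotentNormalChain E (m + 1) c) : Group.IsNilpotent (c 1) := by
  obtain ⟨hbot, -, -, hn, hnil⟩ := hc
  have := hn 0
  have := hnil 0 (Nat.succ_pos m)
  refine Subgroup.isNilpotent_of_ker_le_center ((QuotientGroup.mk' (c 0)).subgroupMap (c 1)) ?_
  intro x hx
  have hx0 : (x : E) ∈ c 0 := (QuotientGroup.eq_one_iff (x : E)).1 (congrArg Subtype.val hx)
  rw [hbot, mem_bot] at hx0
  have hx1 : x = 1 := Subtype.ext hx0
  exact hx1 ▸ one_mem _

theorem IsTower.extension [Finite E] {k : ℕ} (hG : IsTower k G) {f : E →* G}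
    (hf : Function.Surjective f) (hV : IsSelfCentralizingMinimal f.ker)
    (hcop : (Nat.card f.ker).Coprime (Nat.card G)) : IsTower (k + 1) E where
  solvable := by
    have := hG.solvable
    have hcomm : IsMulCommutative f.ker :=
      le_centralizer_iff_isMulCommutative.1 hV.centralizer_eq.ge
    have : Group.IsSolvable f.ker := Group.isSolvable_of_comm fun a b => hcomm.is_comm.comm a b
    exact Group.isSolvable_of_ker_le_range f.ker.subtype f (range_subtype _).ge
  exists_prime_not_dvd M hM := by
    by_cases hVM : f.ker ≤ M
    · obtain ⟨K, rfl⟩ : ∃ K : Subgroup G, K.comap f = M := ⟨M.map f, comap_map_eq_self hVM⟩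
      have hK : IsCoatom K := by
        refine ⟨fun h => hM.1 (by rw [h, comap_top]), fun L hL => comap_injective hf ?_⟩
        rw [comap_top]
        exact hM.2 _ ((comap_lt_comap_of_surjective hf).2 hL)
      obtain ⟨q, hq, hqG, hqK⟩ := hG.exists_prime_not_dvd K hK
      refine ⟨q, hq, hqG.trans (card_dvd_of_surjective f hf), fun hdvd => ?_⟩
      have hcard : Nat.card (K.comap f) = Nat.card f.ker * Nat.card K := by
        have hindex : K.index ≠ 0 := by
          rw [← index_comap_of_surjective K hf]
          exact index_ne_zero_of_finite
        have hE := (K.comap f).card_mul_index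
        rw [index_comap_of_surjective K hf, ← f.ker.card_mul_index, index_ker,
          MonoidHom.range_eq_top.2 hf, card_top, ← K.card_mul_index, ← mul_assoc] at hE
        exact Nat.eq_of_mul_eq_mul_right (Nat.pos_of_ne_zero hindex) hE
      rw [hcard, hq.dvd_mul] at hdvd
      exact hdvd.elim (fun h => hq.one_lt.ne' (Nat.eq_one_of_dvd_coprimes hcop h hqG)) hqK
    · have hinf := hV.inf_eq_bot_of_isCoatom hM hVM
      have hne : Nat.card f.ker ≠ 1 := fun h => hV.ne_bot (card_eq_one.1 h)
      obtain ⟨q, hq, hqV⟩ := Nat.exists_prime_and_dvd hne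
      refine ⟨q, hq, hqV.trans (card_subgroup_dvd_card _), fun hqM => ?_⟩
      have hinj : Function.Injective (f.comp M.subtype) := by
        rw [injective_iff_map_eq_one]
        intro x hx
        have hmem : (x : E) ∈ M ⊓ f.ker := ⟨x.2, hx⟩
        rw [hinf, mem_bot] at hmem
        exact Subtype.ext hmem
      exact hq.one_lt.ne'
        (Nat.eq_one_of_dvd_coprimes hcop hqV (hqM.trans (card_dvd_of_injective _ hinj)))
  exists_monolith := by
    obtain ⟨v, hv, hv1⟩ := (bot_or_exists_ne_one f.ker).resolve_left hV.ne_bot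
    exact ⟨v, hv1, fun N hN => (hV.eq_bot_or_le N).imp_right fun h => h hv⟩
  le_length m c hc := by
    cases m with
    | zero =>
      refine absurd (le_bot_iff.1 ?_) hV.ne_bot
      rw [← hc.1, hc.2.1]
      exact le_top
    | succ m =>
      have := isNilpotent_one_of_chain hc
      have : (c 1).Normal := hc.2.2.2.1 1
      exact Nat.succ_le_succ
        (hG.le_length m _ (isNilpotentNormalChain_map hf hc (hV.le_of_isNilpotent (c 1))))

end Extension

section Module

open MonoidAlgebra SemidirectProduct

variable {p : ℕ} {G : Type*} [Group G]

/-- The action of `G` on the underlying group of a module over its group algebra. -/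
noncomputable def moduleAut (p : ℕ) (G W : Type*) [Group G] [AddCommGroup W]
    [Module (MonoidAlgebra (ZMod p) G) W] : G →* MulAut (Multiplicative W) where
  toFun g := MonoidHom.toMulEquiv
    (AddMonoidHom.toMultiplicative (DistribSMul.toAddMonoidHom W (of (ZMod p) G g)))
    (AddMonoidHom.toMultiplicative (DistribSMul.toAddMonoidHom W (of (ZMod p) G g⁻¹)))
    (by ext w; simp [← mul_smul, ← map_mul, -of_apply])
    (by ext w; simp [← mul_smul, ← map_mul, -of_apply])
  map_one' := by ext w; simp [-of_apply, map_one]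
  map_mul' g h := by ext w; simp [← mul_smul, -of_apply, map_mul]

variable {W : Type*} [AddCommGroup W] [Module (MonoidAlgebra (ZMod p) G) W]

@[simp]
theorem moduleAut_apply_ofAdd (g : G) (w : W) :
    moduleAut p G W g (Multiplicative.ofAdd w) = Multiplicative.ofAdd (of (ZMod p) G g • w) :=
  rfl

/-- The submodule of `W` corresponding to a normal subgroup of `W ⋊ G`. -/
def submoduleOfNormal [NeZero p] (N : Subgroup (Multiplicative W ⋊[moduleAut p G W] G))
    [hN : N.Normal] : Submodule (MonoidAlgebra (ZMod p) G) W where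
  carrier := {w | inl (Multiplicative.ofAdd w) ∈ N}
  add_mem' {a b} ha hb := by
    rw [Set.mem_ofPred_eq, ofAdd_add, map_mul]
    exact mul_mem ha hb
  zero_mem' := by simp [one_mem]
  smul_mem' r w hw := by
    induction r using MonoidAlgebra.induction_on with
    | of g =>
      rw [Set.mem_ofPred_eq, ← moduleAut_apply_ofAdd, inl_aut, map_inv]
      exact hN.conj_mem _ hw _
    | add x y hx hy =>
      rw [Set.mem_ofPred_eq, add_smul, ofAdd_add, map_mul]
      exact mul_mem hx hy
    | smul a x hx =>
      obtain ⟨n, rfl⟩ := ZMod.natCast_zmod_surjective a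
      rw [Set.mem_ofPred_eq, Nat.cast_smul_eq_nsmul, smul_assoc, ofAdd_nsmul, map_pow]
      exact pow_mem hx n

/-- A faithful simple module is a self-centralizing minimal normal subgroup of its semidirect
product with the group. -/
theorem isSelfCentralizingMinimal_ker_rightHom [NeZero p]
    [IsSimpleModule (MonoidAlgebra (ZMod p) G) W]
    (hfaith : ∀ g : G, (∀ w : W, of (ZMod p) G g • w = w) → g = 1) :
    IsSelfCentralizingMinimal
      (rightHom : Multiplicative W ⋊[moduleAut p G W] G →* G).ker where
  normal := inferInstance
  ne_bot h := by
    have := IsSimpleModule.nontrivial (MonoidAlgebra (ZMod p) G) W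
    obtain ⟨w, hw⟩ := exists_ne (0 : W)
    have hmem : (inl (Multiplicative.ofAdd w) : Multiplicative W ⋊[moduleAut p G W] G) ∈
        rightHom.ker := by simp [MonoidHom.mem_ker]
    rw [h, mem_bot, ← map_one inl, inl_inj] at hmem
    exact hw hmem
  minimal N hN hle := by
    refine (eq_bot_or_eq_top (submoduleOfNormal N)).imp (fun h => ?_) fun h => ?_
    · rw [eq_bot_iff]
      intro x hx
      obtain ⟨w, rfl⟩ := range_inl_eq_ker_rightHom.ge (hle hx)
      have hw : w.toAdd ∈ submoduleOfNormal N := hx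
      rw [h, Submodule.mem_bot] at hw
      rw [mem_bot, show w = 1 from hw, map_one]
    · refine le_antisymm hle fun x hx => ?_
      obtain ⟨w, rfl⟩ := range_inl_eq_ker_rightHom.ge hx
      have hw : w.toAdd ∈ submoduleOfNormal N := h ▸ Submodule.mem_top
      exact hw
  centralizer_eq := by
    apply le_antisymm
    · intro x hx
      rw [MonoidHom.mem_ker, rightHom_eq_right]
      refine hfaith _ fun w => ?_
      have h := congrArg left (mem_centralizer_iff.1 hx (inl (Multiplicative.ofAdd w))
        (by simp [MonoidHom.mem_ker]))
      simp only [mul_left, left_inl, right_inl, map_one, MulAut.one_apply,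
        moduleAut_apply_ofAdd] at h
      rw [mul_comm] at h
      exact (Multiplicative.ofAdd.injective (mul_left_cancel h)).symm
    · intro x hx
      obtain ⟨w, rfl⟩ := range_inl_eq_ker_rightHom.ge hx
      rw [mem_centralizer_iff]
      intro y hy
      obtain ⟨v, rfl⟩ := range_inl_eq_ker_rightHom.ge hy
      rw [← map_mul, ← map_mul, mul_comm]

end Module

open MonoidAlgebra in
/-- A finite group with a unique minimal normal subgroup has a faithful simple module over
`ZMod p` for every prime `p` not dividing its order. -/
theorem exists_faithful_maximal_ideal {G : Type*} [Group G] [Finite G] {p : ℕ} [Fact p.Prime]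
    (hp : ¬ p ∣ Nat.card G)
    (hmono : ∃ g : G, g ≠ 1 ∧ ∀ N : Subgroup G, N.Normal → N = ⊥ ∨ g ∈ N) :
    ∃ I : Ideal (MonoidAlgebra (ZMod p) G), IsCoatom I ∧
      ∀ g : G, (∀ w : MonoidAlgebra (ZMod p) G ⧸ I, of (ZMod p) G g • w = w) → g = 1 := by
  obtain ⟨g, hg, hN⟩ := hmono
  have : NeZero (Nat.card G : ZMod p) := ⟨by rwa [Ne, ZMod.natCast_eq_zero_iff]⟩
  have hjac := IsSemisimpleModule.jacobson_eq_bot (MonoidAlgebra (ZMod p) G)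
    (MonoidAlgebra (ZMod p) G)
  have hg' : of (ZMod p) G g - 1 ∉ Module.jacobson (MonoidAlgebra (ZMod p) G)
      (MonoidAlgebra (ZMod p) G) := by
    rw [hjac, Submodule.mem_bot, sub_eq_zero, ← map_one (of (ZMod p) G)]
    exact fun h => hg (of_injective h)
  rw [Module.jacobson, Submodule.mem_sInf] at hg'
  push Not at hg'
  obtain ⟨I, hI, hgI⟩ := hg'
  refine ⟨I, hI, fun h hh => ?_⟩
  let ρ := moduleAut p G (MonoidAlgebra (ZMod p) G ⧸ I)
  have hker : ρ.ker = ⊥ := by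
    refine (hN ρ.ker inferInstance).resolve_right fun hmem => hgI ?_
    have h1 := congrArg Multiplicative.toAdd (DFunLike.congr_fun (MonoidHom.mem_ker.1 hmem)
      (Multiplicative.ofAdd (Submodule.Quotient.mk (1 : MonoidAlgebra (ZMod p) G))))
    refine (Submodule.Quotient.eq I).1 (Eq.trans ?_ h1)
    change _ = of (ZMod p) G g • Submodule.Quotient.mk (p := I) 1
    rw [← Submodule.Quotient.mk_smul, smul_eq_mul, mul_one]
  have hmem : h ∈ ρ.ker := by
    rw [MonoidHom.mem_ker]
    ext w
    exact hh _
  rwa [hker, mem_bot] at hmem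

theorem IsTower.exists_succ {G : Type} [Group G] [Finite G] {k : ℕ} (hG : IsTower k G) :
    ∃ (E : Type) (_ : Group E) (_ : Finite E), IsTower (k + 1) E := by
  obtain ⟨p, hpG, hp⟩ := Nat.exists_infinite_primes (Nat.card G + 1)
  have : Fact p.Prime := ⟨hp⟩
  have hdvd : ¬ p ∣ Nat.card G := Nat.not_dvd_of_pos_of_lt Nat.card_pos hpG
  obtain ⟨I, hI, hfaith⟩ := exists_faithful_maximal_ideal hdvd hG.exists_monolith
  let R := MonoidAlgebra (ZMod p) G
  have := isSimpleModule_iff_isCoatom.2 hI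
  let e : R ≃ (G → ZMod p) := MonoidAlgebra.coeffEquiv.trans Finsupp.equivFunOnFinite
  have : Finite R := .of_equiv _ e.symm
  have : Finite (R ⧸ I) := .of_surjective _ (Submodule.Quotient.mk_surjective I)
  have : Finite (Multiplicative (R ⧸ I)) := inferInstanceAs (Finite (R ⧸ I))
  let E := SemidirectProduct (Multiplicative (R ⧸ I)) G (moduleAut p G (R ⧸ I))
  have : Finite E := .of_equiv _ SemidirectProduct.equivProd.symm
  refine ⟨E, inferInstance, this, hG.extension SemidirectProduct.rightHom_surjective
    (isSelfCentralizingMinimal_ker_rightHom hfaith) ?_⟩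
  have hcard : Nat.card R = p ^ Nat.card G := by
    rw [Nat.card_congr e, Nat.card_fun, Nat.card_zmod]
  have hquot : Nat.card (R ⧸ I) ∣ p ^ Nat.card G :=
    hcard ▸ AddSubgroup.card_quotient_dvd_card I.toAddSubgroup
  rw [← SemidirectProduct.range_inl_eq_ker_rightHom,
    ← Nat.card_congr (MonoidHom.ofInjective SemidirectProduct.inl_injective).toEquiv]
  exact Nat.Coprime.coprime_dvd_left hquot
    (((Nat.Prime.coprime_iff_not_dvd hp).2 hdvd).pow_left _)

theorem isTower_one : IsTower 1 (Multiplicative (ZMod 2)) := by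
  have hcard : Nat.card (Multiplicative (ZMod 2)) = 2 := Nat.card_zmod 2
  have hsimple : IsSimpleGroup (Multiplicative (ZMod 2)) := isSimpleGroup_of_prime_card hcard
  refine ⟨inferInstance, fun M hM => ⟨2, Nat.prime_two, hcard.symm.dvd, ?_⟩, ?_, fun m c hc => ?_⟩
  · rw [(IsSimpleGroup.eq_bot_or_eq_top_of_normal M inferInstance).resolve_right hM.1, card_bot]
    decide
  · obtain ⟨g, hg⟩ := exists_ne (1 : Multiplicative (ZMod 2))
    exact ⟨g, hg, fun N hN => (IsSimpleGroup.eq_bot_or_eq_top_of_normal N hN).imp_right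
      fun h : N = ⊤ => h ▸ mem_top g⟩
  · rw [Nat.one_le_iff_ne_zero]
    rintro rfl
    exact bot_ne_top (hc.1.symm.trans hc.2.1)

theorem exists_tower (k : ℕ) :
    ∃ (G : Type) (_ : Group G) (_ : Finite G), IsTower (k + 1) G := by
  induction k with
  | zero => exact ⟨_, inferInstance, inferInstance, isTower_one⟩
  | succ k ih =>
    obtain ⟨G, _, _, hG⟩ := ih
    exact hG.exists_succ

end FittingTower

/-- Theorem B (nilpotency length): there are finite solvable groups of arbitrarily
large nilpotency (Fitting) length in which every maximal subgroup `M` with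
`π(M) = π(G)` is supersolvable. -/
theorem exists_solvable_group_maximal_pi_supersolvable_large_fitting_length (n : ℕ) :
    ∃ (G : Type) (_ : Group G) (_ : Finite G), IsSolvable G ∧
      (∀ M : Subgroup G, IsCoatom M →
        (Nat.card M).primeFactors = (Nat.card G).primeFactors → IsSupersolvable M) ∧
      ∀ (m : ℕ) (c : ℕ → Subgroup G), IsNilpotentNormalChain G m c → n ≤ m := by
  obtain ⟨G, hG, hfin, h⟩ := FittingTower.exists_tower n
  refine ⟨G, hG, hfin, h.solvable, fun M hM hMG => ?_, fun m c hc => ?_⟩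
  · obtain ⟨q, hq, hqG, hqM⟩ := h.exists_prime_not_dvd M hM
    have hmem : q ∈ (Nat.card M).primeFactors := by
      rw [hMG]
      exact Nat.mem_primeFactors.2 ⟨hq, hqG, Nat.card_pos.ne'⟩
    exact absurd (Nat.dvd_of_mem_primeFactors hmem) hqM
  · exact (Nat.le_succ n).trans (h.le_length m c hc)
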